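/- For every element y = τ_α(y(p,e,b,g)) of the slice Gr⁰_{−α} ⊂ Gr_{−α}, one has Φ_{α,k}(y) = e ≠ 0 (so that ξ_α(y) is defined) and ξ_α(y) = y. In other words, the map ξ_α restricted to Gr⁰_{−α} is the identity. -/

import Mathlib

open Matrix

noncomputable section

/-- `K = ℂ((t⁻¹))`, the field of formal Laurent series in `t⁻¹`.  We realize it as
`LaurentSeries ℂ`, where the Laurent-series variable `X` plays the role of `t⁻¹`;
thus for `f : K`, `f.coeff j` is the coefficient of `t^{-j}`. -/
abbrev K : Type := LaurentSeries ℂ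

/-- The element `t` (the inverse of the Laurent series variable). -/
def tK : K := (HahnSeries.single (-1 : ℤ) (1 : ℂ))

/-- The constant embedding `ℂ → K`. -/
def Cc (z : ℂ) : K := HahnSeries.C z

/-- `f ∈ 𝒪 = ℂ[[t⁻¹]]` : no positive powers of `t`. -/
def memO (f : K) : Prop := ∀ j : ℤ, j < 0 → f.coeff j = 0

/-- `f ∈ 𝒪₁ = t⁻¹ℂ[[t⁻¹]]`. -/
def memO1 (f : K) : Prop := ∀ j : ℤ, j ≤ 0 → f.coeff j = 0

/-- `f ∈ ℂ[t]`. -/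
def memPoly (f : K) : Prop := ∀ j : ℤ, 0 < j → f.coeff j = 0

/-- Upper unitriangular matrix. -/
def IsUpperUni {R : Type*} [Zero R] [One R] {m : ℕ} (M : Matrix (Fin m) (Fin m) R) : Prop :=
  (∀ i, M i i = 1) ∧ ∀ i j : Fin m, j < i → M i j = 0

/-- Lower unitriangular matrix. -/
def IsLowerUni {R : Type*} [Zero R] [One R] {m : ℕ} (M : Matrix (Fin m) (Fin m) R) : Prop :=
  (∀ i, M i i = 1) ∧ ∀ i j : Fin m, i < j → M i j = 0

/-- `M ∈ N₁[[t⁻¹]]` : upper unitriangular with off-diagonal entries in `𝒪₁`. -/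
def MemN1 {m : ℕ} (M : Matrix (Fin m) (Fin m) K) : Prop :=
  IsUpperUni M ∧ ∀ i j : Fin m, i ≠ j → memO1 (M i j)

/-- `M ∈ N₋,₁[[t⁻¹]]`. -/
def MemN1neg {m : ℕ} (M : Matrix (Fin m) (Fin m) K) : Prop :=
  IsLowerUni M ∧ ∀ i j : Fin m, i ≠ j → memO1 (M i j)

/-- `M ∈ T₁[[t⁻¹]]` : diagonal with entries in `1 + 𝒪₁`. -/
def MemT1 {m : ℕ} (M : Matrix (Fin m) (Fin m) K) : Prop :=
  (∀ i j : Fin m, i ≠ j → M i j = 0) ∧ ∀ i, memO1 (M i i - 1)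

/-- `M ∈ N[t]` : upper unitriangular with entries in `ℂ[t]`. -/
def MemNpoly {m : ℕ} (M : Matrix (Fin m) (Fin m) K) : Prop :=
  IsUpperUni M ∧ ∀ i j : Fin m, memPoly (M i j)

/-- `M ∈ N₋[t]` : lower unitriangular with entries in `ℂ[t]`. -/
def MemNnegPoly {m : ℕ} (M : Matrix (Fin m) (Fin m) K) : Prop :=
  IsLowerUni M ∧ ∀ i j : Fin m, memPoly (M i j)

/-- `t^ν = diag(t^{ν₁},…,t^{ν_m})`. -/
def tPow {m : ℕ} (ν : Fin m → ℤ) : Matrix (Fin m) (Fin m) K :=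
  Matrix.diagonal fun i => tK ^ ν i

/-- `y = u · h · t^ν · l` is a Gauss factorization exhibiting membership in `Gr_ν`. -/
def IsGauss {m : ℕ} (ν : Fin m → ℤ) (y u h l : Matrix (Fin m) (Fin m) K) : Prop :=
  MemN1 u ∧ MemT1 h ∧ MemN1neg l ∧ y = u * h * tPow ν * l

/-- The matrix slice `Gr_ν = N₁[[t⁻¹]]·T₁[[t⁻¹]]·t^ν·N₋,₁[[t⁻¹]]`. -/
def GrSlice {m : ℕ} (ν : Fin m → ℤ) : Set (Matrix (Fin m) (Fin m) K) :=
  { y | ∃ u h l, IsGauss ν y u h l }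

/-- Block embedding `τ_α : Mat_{k+1} → Mat_n` into (1-indexed) rows and columns `r₁,…,r₁+k`,
identity outside this block. -/
def blockEmbed {R : Type*} [Zero R] [One R] (n r₁ k : ℕ)
    (g : Matrix (Fin (k+1)) (Fin (k+1)) R) : Matrix (Fin n) (Fin n) R :=
  fun i j =>
    if h : r₁ - 1 ≤ (i : ℕ) ∧ (i : ℕ) ≤ r₁ - 1 + k ∧ r₁ - 1 ≤ (j : ℕ) ∧ (j : ℕ) ≤ r₁ - 1 + k then
      g ⟨(i : ℕ) - (r₁ - 1), by omega⟩ ⟨(j : ℕ) - (r₁ - 1), by omega⟩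
    else if i = j then 1 else 0

/-- The coweight `α` of `PGL_n` : `α_{r₁} = 1`, `α_{r₂+1} = -1` (1-indexed), all other
entries `0`. -/
def alphaCo (n r₁ r₂ : ℕ) : Fin n → ℤ :=
  fun i => if (i : ℕ) = r₁ - 1 then 1 else if (i : ℕ) = r₂ then -1 else 0

/-- The matrix `y(p,e,b,g)` (matrix representative of a point of the open Zastava
`Gr⁰_{-α}`), a `(k+1)×(k+1)` matrix over `ℂ[t] ⊆ K`. -/
def ymat (k : ℕ) (p e : ℂ) (b g : Fin (k-1) → ℂ) :
    Matrix (Fin (k+1)) (Fin (k+1)) K :=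
  fun i j =>
    if _hi0 : (i : ℕ) = 0 then
      (if _hjk : (j : ℕ) = k then Cc e else 0)
    else if _hik : (i : ℕ) = k then
      (if _hj0 : (j : ℕ) = 0 then Cc (-e⁻¹)
       else if _hjk : (j : ℕ) = k then tK - Cc (p + ∑ l : Fin (k-1), b l * g l)
       else Cc (-(g ⟨k - (j : ℕ) - 1, by have := j.isLt; omega⟩)))
    else
      (if _hji : (j : ℕ) = (i : ℕ) then 1
       else if _hjk : (j : ℕ) = k then Cc (b ⟨k - (i : ℕ) - 1, by have := i.isLt; omega⟩)
       else 0)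

/-- The matrix `x₋(v)` over `K` : identity except for the bottom row `(v_k,…,v₁,1)`. -/
def xminusK (k : ℕ) (v : Fin k → ℂ) : Matrix (Fin (k+1)) (Fin (k+1)) K :=
  fun i j =>
    if _hik : (i : ℕ) = k then
      (if _hjk : (j : ℕ) = k then 1 else Cc (v ⟨k - (j : ℕ) - 1, by have := j.isLt; omega⟩))
    else if i = j then 1 else 0

/-- `Φ_α(y)` read off from the `N₁[[t⁻¹]]`-factor `u` of a Gauss factorization of `y`. -/
def PhiOf (n r₂ k : ℕ) (hrn : r₂ < n) (u : Matrix (Fin n) (Fin n) K) : Fin k → ℂ :=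
  fun a => (u ⟨r₂ - 1 - (a : ℕ), by omega⟩ ⟨r₂, hrn⟩).coeff 1

/-- `ζ_α(y)` read off from the `N₁[[t⁻¹]]`-factor `u` of a Gauss factorization of `y`. -/
def ZetaOf (n r₁ r₂ k : ℕ) (hr1 : 1 ≤ r₁) (hrr : r₁ ≤ r₂) (hrn : r₂ < n)
    (hk : k = r₂ - r₁ + 1) (u : Matrix (Fin n) (Fin n) K) : Fin k → ℂ :=
  fun a =>
    if _ha : (a : ℕ) = k - 1 then (u ⟨r₁ - 1, by omega⟩ ⟨r₂, hrn⟩).coeff 2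
    else (u ⟨r₁ - 1, by omega⟩ ⟨r₁ + (a : ℕ), by have := a.isLt; omega⟩).coeff 1

/-- `ξ_α(y)`, computed from the `N₁[[t⁻¹]]`-factor `u` of a Gauss factorization of `y`. -/
def xiOf (n r₁ r₂ k : ℕ) (hr1 : 1 ≤ r₁) (hrr : r₁ ≤ r₂) (hrn : r₂ < n)
    (hk : k = r₂ - r₁ + 1) (u : Matrix (Fin n) (Fin n) K) : Matrix (Fin n) (Fin n) K :=
  let c := PhiOf n r₂ k hrn u
  let z := ZetaOf n r₁ r₂ k hr1 hrr hrn hk u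
  let e : ℂ := c ⟨k - 1, by omega⟩
  let b : Fin (k-1) → ℂ := fun i => c ⟨(i : ℕ), by have := i.isLt; omega⟩
  let g : Fin (k-1) → ℂ := fun i => z ⟨k - (i : ℕ) - 2, by omega⟩ / e
  let p : ℂ := z ⟨k - 1, by omega⟩ / e - ∑ i : Fin (k-1), b i * g i
  blockEmbed n r₁ k (ymat k p e b g)

/-- `M` has identity submatrix in (1-indexed) rows and columns `r₁,…,r₁+k`. -/
def HasIdBlock {R : Type*} [Zero R] [One R] {n : ℕ} (r₁ k : ℕ)
    (M : Matrix (Fin n) (Fin n) R) : Prop :=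
  ∀ i j : Fin n, r₁ - 1 ≤ (i : ℕ) → (i : ℕ) ≤ r₁ - 1 + k →
    r₁ - 1 ≤ (j : ℕ) → (j : ℕ) ≤ r₁ - 1 + k →
    M i j = if i = j then 1 else 0

/-- `M ∈ N^α(K)` : upper unitriangular over `K` with identity `(k+1)×(k+1)`-block. -/
def MemNalphaK (n r₁ k : ℕ) (M : Matrix (Fin n) (Fin n) K) : Prop :=
  IsUpperUni M ∧ HasIdBlock r₁ k M

/-- `M ∈ N^α[t]`. -/
def MemNalphaPoly (n r₁ k : ℕ) (M : Matrix (Fin n) (Fin n) K) : Prop :=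
  MemNalphaK n r₁ k M ∧ ∀ i j : Fin n, memPoly (M i j)

/-- `M ∈ N(K)^α₁ = x_α(N_{1,k+1}[[t⁻¹]])·N^α(K)`. -/
def MemNKalpha1 (n r₁ k : ℕ) (M : Matrix (Fin n) (Fin n) K) : Prop :=
  ∃ (a : Matrix (Fin (k+1)) (Fin (k+1)) K) (u : Matrix (Fin n) (Fin n) K),
    MemN1 a ∧ MemNalphaK n r₁ k u ∧ M = blockEmbed n r₁ k a * u

/-- `z = π(x)` for the slice `Gr_ν` : `z ∈ Gr_ν` and `z = a·x·b` with `a ∈ N[t]`,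
`b ∈ N₋[t]`. -/
def IsPiOf {n : ℕ} (ν : Fin n → ℤ) (x z : Matrix (Fin n) (Fin n) K) : Prop :=
  z ∈ GrSlice ν ∧ ∃ a b, MemNpoly a ∧ MemNnegPoly b ∧ z = a * x * b

/-- The open Zastava slice `Gr⁰_{-α} ⊆ GL_n(K)` : matrices `τ_α(y(p,e,b,g))`. -/
def GrZeroNegAlpha (n r₁ k : ℕ) : Set (Matrix (Fin n) (Fin n) K) :=
  { M | ∃ (p e : ℂ) (b g : Fin (k-1) → ℂ), e ≠ 0 ∧ M = blockEmbed n r₁ k (ymat k p e b g) }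

/-- `μ + α`. -/
def addAlpha (n r₁ r₂ : ℕ) (μ : Fin n → ℤ) : Fin n → ℤ :=
  fun i => μ i + alphaCo n r₁ r₂ i


section Laurent

lemma tK_mul_single_one : tK * (HahnSeries.single (1 : ℤ) (1 : ℂ) : K) = 1 := by
  rw [tK, HahnSeries.single_mul_single]
  simp

lemma tK_ne_zero : tK ≠ 0 := left_ne_zero_of_mul_eq_one tK_mul_single_one

lemma coeff_Cc_mul (c : ℂ) (f : K) (j : ℤ) : (Cc c * f).coeff j = c * f.coeff j := by
  simp [Cc]

lemma coeff_tK_mul (f : K) (j : ℤ) : (tK * f).coeff j = f.coeff (j + 1) := by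
  rw [tK, HahnSeries.coeff_single_mul]
  simp

lemma tK_sub_Cc_ne_zero (c : ℂ) : tK - Cc c ≠ 0 := by
  intro h
  have := congrArg (fun f : K => f.coeff (-1)) h
  simp [tK, Cc, HahnSeries.C_apply] at this

/-- The coefficients of `(t - c)⁻¹` satisfy a first order recursion. -/
lemma coeff_inv_succ (c : ℂ) (j : ℤ) :
    ((tK - Cc c)⁻¹).coeff (j + 1) = c * ((tK - Cc c)⁻¹).coeff j + if j = 0 then 1 else 0 := by
  have h := congrArg (fun f : K => f.coeff j) (mul_inv_cancel₀ (tK_sub_Cc_ne_zero c))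
  simp only [sub_mul, HahnSeries.coeff_sub, coeff_tK_mul, coeff_Cc_mul, HahnSeries.coeff_one] at h
  split_ifs at h ⊢ <;> linear_combination h

lemma memO1_inv (c : ℂ) : memO1 ((tK - Cc c)⁻¹) := by
  set w := (tK - Cc c)⁻¹ with hw
  have key : ∀ m : ℕ, ∀ j : ℤ, j ≤ 0 → j < w.order + m → w.coeff j = 0 := by
    intro m
    induction m with
    | zero => exact fun j _ hj => HahnSeries.coeff_eq_zero_of_lt_order (by simpa using hj)
    | succ m ih =>
      intro j hj hjm
      have h := coeff_inv_succ c (j - 1)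
      rw [sub_add_cancel, ← hw, ih (j - 1) (by omega) (by push_cast at hjm; omega),
        if_neg (by omega)] at h
      simpa using h
  intro j hj
  exact key (j - w.order + 1).toNat j hj (by omega)

lemma coeff_inv_one (c : ℂ) : ((tK - Cc c)⁻¹).coeff 1 = 1 := by
  have h := coeff_inv_succ c 0
  rw [memO1_inv c 0 le_rfl] at h
  simpa using h

lemma coeff_inv_two (c : ℂ) : ((tK - Cc c)⁻¹).coeff 2 = c := by
  have h := coeff_inv_succ c 1
  rw [coeff_inv_one] at h
  simpa using h

lemma memO1_Cc_mul {f : K} (c : ℂ) (hf : memO1 f) : memO1 (Cc c * f) := fun j hj => by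
  rw [coeff_Cc_mul, hf j hj, mul_zero]

lemma memO1_zero : memO1 0 := fun _ _ => rfl

lemma ne_zero_of_memO1_sub_one {f : K} (hf : memO1 (f - 1)) : f ≠ 0 := by
  rintro rfl
  simpa using hf 0 le_rfl

end Laurent

section Uniqueness

lemma IsUpperUni.blockTriangular {R : Type*} [Zero R] [One R] {m : ℕ}
    {M : Matrix (Fin m) (Fin m) R} (h : IsUpperUni M) : M.BlockTriangular id :=
  fun i j hij => h.2 i j hij

lemma IsLowerUni.blockTriangular {R : Type*} [Zero R] [One R] {m : ℕ}
    {M : Matrix (Fin m) (Fin m) R} (h : IsLowerUni M) : M.BlockTriangular OrderDual.toDual :=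
  fun i j hij => h.2 i j hij

lemma MemT1.eq_diagonal {m : ℕ} {M : Matrix (Fin m) (Fin m) K} (h : MemT1 M) :
    M = Matrix.diagonal fun i => M i i := by
  ext1 i j
  by_cases hij : i = j
  · simp [hij]
  · simp [hij, h.1 i j hij]

/-- The upper unitriangular factor of a Gauss factorization is unique. -/
lemma IsGauss.upper_unique {m : ℕ} {ν : Fin m → ℤ} {y u h l u' h' l' : Matrix (Fin m) (Fin m) K}
    (H : IsGauss ν y u h l) (H' : IsGauss ν y u' h' l') : u = u' := by
  have lower : ∀ {u h l : Matrix (Fin m) (Fin m) K}, IsGauss ν y u h l →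
      ((h * tPow ν) * l).BlockTriangular OrderDual.toDual ∧ IsUnit ((h * tPow ν) * l).det := by
    rintro u h l ⟨-, hh, hl, -⟩
    constructor
    · refine BlockTriangular.mul (BlockTriangular.mul ?_ ?_) hl.1.blockTriangular
      · rw [hh.eq_diagonal]; exact blockTriangular_diagonal _
      · exact blockTriangular_diagonal _
    · rw [isUnit_iff_ne_zero, det_mul, det_mul, hh.eq_diagonal, tPow, det_diagonal, det_diagonal,
        det_of_isLowerTriangular l hl.1.blockTriangular]
      refine mul_ne_zero (mul_ne_zero ?_ ?_) ?_
      · exact Finset.prod_ne_zero_iff.2 fun i _ => ne_zero_of_memO1_sub_one (hh.2 i)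
      · exact Finset.prod_ne_zero_iff.2 fun i _ => zpow_ne_zero _ tK_ne_zero
      · simp [hl.1.1]
  obtain ⟨hP, hPu⟩ := lower H
  obtain ⟨hP', -⟩ := lower H'
  obtain ⟨hu, -, -, hy⟩ := H
  obtain ⟨hu', -, -, hy'⟩ := H'
  set P := (h * tPow ν) * l
  set P' := (h' * tPow ν) * l'
  have hu'det : IsUnit u'.det := by
    rw [det_of_isUpperTriangular hu'.1.blockTriangular]
    simp [hu'.1.1]
  have hyP : u * P = u' * P' := by
    rw [← Matrix.mul_assoc, ← Matrix.mul_assoc, ← Matrix.mul_assoc, ← Matrix.mul_assoc, ← hy, ← hy']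
  let _ := Matrix.invertibleOfIsUnitDet P hPu
  let _ := Matrix.invertibleOfIsUnitDet u' hu'det
  set A := u'⁻¹ * u with hA
  have hAup : A.BlockTriangular id :=
    (blockTriangular_inv_of_blockTriangular hu'.1.blockTriangular).mul hu.1.blockTriangular
  have hAP : A = P' * P⁻¹ := by
    rw [hA, ← Matrix.mul_nonsing_inv_cancel_right P u hPu, hyP]
    simp [Matrix.mul_assoc]
  have hAlow : A.BlockTriangular OrderDual.toDual :=
    hAP ▸ hP'.mul (blockTriangular_inv_of_blockTriangular hP)
  have huA : u = u' * A := by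
    rw [hA, Matrix.mul_nonsing_inv_cancel_left _ _ hu'det]
  have hAdiag : A = Matrix.diagonal fun i => A i i := by
    ext1 i j
    rcases lt_trichotomy i j with hij | hij | hij
    · rw [hAlow hij, diagonal_apply_ne _ hij.ne]
    · simp [hij]
    · rw [hAup hij, diagonal_apply_ne _ hij.ne']
  rw [hAdiag] at huA
  have hA1 : ∀ i, A i i = 1 := fun i => by
    have := congrFun (congrFun huA i) i
    rw [mul_diagonal, hu.1.1, hu'.1.1, one_mul] at this
    exact this.symm
  rw [huA]
  simp [hA1]

end Uniqueness

section Block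

variable {n r k : ℕ}

/-- The index map underlying `blockEmbed`. -/
def blockIdx (hn : r - 1 + k < n) (i : Fin (k + 1)) : Fin n := ⟨(i : ℕ) + (r - 1), by omega⟩

lemma blockIdx_injective (hn : r - 1 + k < n) : Function.Injective (blockIdx hn) := by
  intro i j h
  simp only [blockIdx, Fin.mk.injEq] at h
  omega

lemma blockIdx_lt_iff (hn : r - 1 + k < n) {i j : Fin (k + 1)} :
    blockIdx hn i < blockIdx hn j ↔ i < j := by
  rw [Fin.lt_def, Fin.lt_def, blockIdx, blockIdx, add_lt_add_iff_right]

lemma exists_blockIdx (hn : r - 1 + k < n) {i : Fin n}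
    (h : r - 1 ≤ (i : ℕ) ∧ (i : ℕ) ≤ r - 1 + k) : ∃ x, i = blockIdx hn x :=
  ⟨⟨(i : ℕ) - (r - 1), by omega⟩, by ext; simp only [blockIdx]; omega⟩

variable {R : Type*}

lemma blockEmbed_blockIdx [Zero R] [One R] (hn : r - 1 + k < n)
    (g : Matrix (Fin (k + 1)) (Fin (k + 1)) R) (i j : Fin (k + 1)) :
    blockEmbed n r k g (blockIdx hn i) (blockIdx hn j) = g i j := by
  rw [blockEmbed, dif_pos (by simp only [blockIdx]; omega)]
  simp [blockIdx]

lemma blockEmbed_of_notMem_left [Zero R] [One R] (hn : r - 1 + k < n)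
    (g : Matrix (Fin (k + 1)) (Fin (k + 1)) R) {i : Fin n} (hi : i ∉ Set.range (blockIdx hn))
    (j : Fin n) : blockEmbed n r k g i j = if i = j then 1 else 0 := by
  rw [blockEmbed, dif_neg]
  rintro ⟨h1, h2, -⟩
  obtain ⟨x, hx⟩ := exists_blockIdx hn ⟨h1, h2⟩
  exact hi ⟨x, hx.symm⟩

lemma blockEmbed_of_notMem_right [Zero R] [One R] (hn : r - 1 + k < n)
    (g : Matrix (Fin (k + 1)) (Fin (k + 1)) R) (i : Fin n) {j : Fin n}
    (hj : j ∉ Set.range (blockIdx hn)) : blockEmbed n r k g i j = if i = j then 1 else 0 := by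
  rw [blockEmbed, dif_neg]
  rintro ⟨-, -, h1, h2⟩
  obtain ⟨x, hx⟩ := exists_blockIdx hn ⟨h1, h2⟩
  exact hj ⟨x, hx.symm⟩

lemma blockEmbed_mul [NonAssocSemiring R] (hn : r - 1 + k < n)
    (A B : Matrix (Fin (k + 1)) (Fin (k + 1)) R) :
    blockEmbed n r k A * blockEmbed n r k B = blockEmbed n r k (A * B) := by
  ext1 i j
  rw [mul_apply]
  by_cases hi : i ∈ Set.range (blockIdx hn)
  · by_cases hj : j ∈ Set.range (blockIdx hn)
    · obtain ⟨i, rfl⟩ := hi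
      obtain ⟨j, rfl⟩ := hj
      rw [blockEmbed_blockIdx, mul_apply]
      refine (Fintype.sum_of_injective (blockIdx hn) (blockIdx_injective hn) _ _ ?_ ?_).symm
      · intro m hm
        rw [blockEmbed_of_notMem_left hn B hm, if_neg (fun h => hm ⟨j, h.symm⟩), mul_zero]
      · intro m
        rw [blockEmbed_blockIdx, blockEmbed_blockIdx]
    · simp [blockEmbed_of_notMem_right hn _ _ hj]
  · simp [blockEmbed_of_notMem_left hn _ hi]

lemma blockEmbed_diagonal [Zero R] [One R] (hn : r - 1 + k < n) (d : Fin n → R)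
    (hd : ∀ i ∉ Set.range (blockIdx hn), d i = 1) :
    Matrix.diagonal d = blockEmbed n r k (Matrix.diagonal fun i => d (blockIdx hn i)) := by
  ext1 i j
  by_cases hi : i ∈ Set.range (blockIdx hn)
  · by_cases hj : j ∈ Set.range (blockIdx hn)
    · obtain ⟨i, rfl⟩ := hi
      obtain ⟨j, rfl⟩ := hj
      simp only [blockEmbed_blockIdx, diagonal_apply, (blockIdx_injective hn).eq_iff]
    · rw [blockEmbed_of_notMem_right hn _ _ hj, diagonal_apply]
      split_ifs with h
      · rw [hd i (h ▸ hj)]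
      · rfl
  · rw [blockEmbed_of_notMem_left hn _ hi, diagonal_apply, hd i hi]

lemma blockEmbed_induction [Zero R] [One R] (hn : r - 1 + k < n)
    (g : Matrix (Fin (k + 1)) (Fin (k + 1)) R) {p : Fin n → Fin n → R → Prop}
    (hin : ∀ i j, p (blockIdx hn i) (blockIdx hn j) (g i j))
    (hout : ∀ i j, p i j (if i = j then 1 else 0)) (i j : Fin n) :
    p i j (blockEmbed n r k g i j) := by
  by_cases hi : i ∈ Set.range (blockIdx hn)
  · by_cases hj : j ∈ Set.range (blockIdx hn)
    · obtain ⟨i, rfl⟩ := hi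
      obtain ⟨j, rfl⟩ := hj
      rw [blockEmbed_blockIdx]
      exact hin i j
    · rw [blockEmbed_of_notMem_right hn _ _ hj]
      exact hout i j
  · rw [blockEmbed_of_notMem_left hn _ hi]
    exact hout i j

lemma MemN1.blockEmbed (hn : r - 1 + k < n) {g : Matrix (Fin (k + 1)) (Fin (k + 1)) K}
    (hg : MemN1 g) : MemN1 (blockEmbed n r k g) := by
  refine ⟨⟨fun i => ?_, ?_⟩, ?_⟩
  · refine blockEmbed_induction hn g (p := fun i j x => i = j → x = 1) ?_ ?_ i i rfl
    · intro i j h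
      obtain rfl := blockIdx_injective hn h
      exact hg.1.1 i
    · rintro i j rfl
      exact if_pos rfl
  · refine blockEmbed_induction hn g (p := fun i j x => j < i → x = 0) ?_ ?_
    · exact fun i j h => hg.1.2 i j ((blockIdx_lt_iff hn).1 h)
    · exact fun i j h => if_neg h.ne'
  · refine blockEmbed_induction hn g (p := fun i j x => i ≠ j → memO1 x) ?_ ?_
    · exact fun i j h => hg.2 i j (fun h' => h (congrArg _ h'))
    · exact fun i j h => by rw [if_neg h]; exact memO1_zero

lemma MemT1.blockEmbed (hn : r - 1 + k < n) {g : Matrix (Fin (k + 1)) (Fin (k + 1)) K}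
    (hg : MemT1 g) : MemT1 (blockEmbed n r k g) := by
  refine ⟨?_, fun i => ?_⟩
  · refine blockEmbed_induction hn g (p := fun i j x => i ≠ j → x = 0) ?_ ?_
    · exact fun i j h => hg.1 i j (fun h' => h (congrArg _ h'))
    · exact fun i j h => if_neg h
  · refine blockEmbed_induction hn g (p := fun i j x => i = j → memO1 (x - 1)) ?_ ?_ i i rfl
    · intro i j h
      obtain rfl := blockIdx_injective hn h
      exact hg.2 i
    · rintro i j rfl
      rw [if_pos rfl, sub_self]
      exact memO1_zero

lemma blockEmbed_transpose [Zero R] [One R] (g : Matrix (Fin (k + 1)) (Fin (k + 1)) R) :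
    (blockEmbed n r k g)ᵀ = blockEmbed n r k gᵀ := by
  ext1 i j
  simp only [transpose_apply, blockEmbed, eq_comm (a := j)]
  split_ifs <;> first | rfl | omega

lemma memN1neg_iff_transpose {m : ℕ} {M : Matrix (Fin m) (Fin m) K} :
    MemN1neg M ↔ MemN1 Mᵀ :=
  ⟨fun h => ⟨⟨h.1.1, fun i j hij => h.1.2 j i hij⟩, fun i j hij => h.2 j i hij.symm⟩,
    fun h => ⟨⟨h.1.1, fun i j hij => h.1.2 j i hij⟩, fun i j hij => h.2 j i hij.symm⟩⟩

lemma MemN1neg.blockEmbed (hn : r - 1 + k < n) {g : Matrix (Fin (k + 1)) (Fin (k + 1)) K}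
    (hg : MemN1neg g) : MemN1neg (blockEmbed n r k g) := by
  rw [memN1neg_iff_transpose] at hg ⊢
  rw [blockEmbed_transpose]
  exact hg.blockEmbed hn

end Block

section Factorization

variable {k : ℕ}

/-- The sequence `x, b_{k-1}, …, b₁, z` of length `k + 1`. -/
def bordered (k : ℕ) (x : ℂ) (b : Fin (k - 1) → ℂ) (z : ℂ) (m : ℕ) : ℂ :=
  if m = 0 then x else if h : k - m - 1 < k - 1 ∧ m < k then b ⟨k - m - 1, h.1⟩ else z

lemma bordered_zero {x z : ℂ} {b : Fin (k - 1) → ℂ} : bordered k x b z 0 = x := if_pos rfl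

lemma bordered_self {x z : ℂ} {b : Fin (k - 1) → ℂ} (hk : k ≠ 0) : bordered k x b z k = z := by
  simp [bordered, hk]

lemma bordered_of_lt {x z : ℂ} {b : Fin (k - 1) → ℂ} {m : ℕ} (h0 : m ≠ 0) (hm : m < k) :
    bordered k x b z m = b ⟨k - m - 1, by omega⟩ := by
  rw [bordered, if_neg h0, dif_pos ⟨by omega, hm⟩]

variable (k : ℕ) (q : ℂ) (β γ : ℕ → ℂ)

/-- The root of the trailing principal minor starting at `m`, the last entry being `t - q`. -/
def minorRoot (m : ℕ) : ℂ := q - ∑ j ∈ Finset.Ico m k, β j * γ j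

/-- The inverse of the trailing principal minor starting at `m`, zero past the last index. -/
def minorInv (m : ℕ) : K := if m ≤ k then (tK - Cc (minorRoot k q β γ m))⁻¹ else 0

/-- The pivots of the upper-diagonal-lower factorization. -/
def pivot (m : ℕ) : K :=
  if m = 0 then minorInv k q β γ 1
  else if m = k then tK - Cc q
  else (tK - Cc (minorRoot k q β γ m)) * minorInv k q β γ (m + 1)

/-- The entries of the upper unitriangular factor. -/
def upperEntry (i j : ℕ) : K :=
  if i = j then 1 else if i < j then Cc (β i * γ j) * minorInv k q β γ j else 0

/-- The upper unitriangular factor. -/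
def upperFactor : Matrix (Fin (k + 1)) (Fin (k + 1)) K := fun i j => upperEntry k q β γ i j

/-- The rank-one perturbed matrix being factored. -/
def borderedMatrix : Matrix (Fin (k + 1)) (Fin (k + 1)) K := fun i j =>
  if (i : ℕ) = k ∧ (j : ℕ) = k then tK - Cc q
  else if (i : ℕ) = k ∨ (j : ℕ) = k then Cc (β i * γ j)
  else if i = j ∧ (i : ℕ) ≠ 0 then 1 else 0

variable {k q β γ}

lemma minorRoot_self : minorRoot k q β γ k = q := by simp [minorRoot]

lemma minorRoot_of_lt {m : ℕ} (hm : m < k) :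
    minorRoot k q β γ m = minorRoot k q β γ (m + 1) - β m * γ m := by
  rw [minorRoot, minorRoot, Finset.sum_eq_sum_Ico_succ_bot hm]
  ring

lemma memO1_minorInv (m : ℕ) : memO1 (minorInv k q β γ m) := by
  rw [minorInv]
  split_ifs
  · exact memO1_inv _
  · exact memO1_zero

lemma minorInv_succ_self : minorInv k q β γ (k + 1) = 0 := if_neg (by omega)

lemma mul_minorInv {m : ℕ} (hm : m ≤ k) :
    (tK - Cc (minorRoot k q β γ m)) * minorInv k q β γ m = 1 := by
  rw [minorInv, if_pos hm, mul_inv_cancel₀ (tK_sub_Cc_ne_zero _)]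

lemma Cc_sub (a b : ℂ) : Cc (a - b) = Cc a - Cc b := map_sub _ _ _

lemma Cc_mul (a b : ℂ) : Cc (a * b) = Cc a * Cc b := map_mul _ _ _

lemma minorInv_mul_pivot {m : ℕ} (h0 : m ≠ 0) (hm : m < k) :
    minorInv k q β γ m * pivot k q β γ m = minorInv k q β γ (m + 1) := by
  rw [pivot, if_neg h0, if_neg hm.ne, ← mul_assoc, mul_comm (minorInv _ _ _ _ _),
    mul_minorInv hm.le, one_mul]

lemma minorInv_mul_pivot_self (hk : k ≠ 0) : minorInv k q β γ k * pivot k q β γ k = 1 := by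
  rw [pivot, if_neg hk, if_pos rfl, mul_comm]
  simpa only [minorRoot_self] using mul_minorInv (q := q) (β := β) (γ := γ) le_rfl

lemma pivot_of_lt {m : ℕ} (h0 : m ≠ 0) (hm : m < k) :
    pivot k q β γ m = 1 + Cc (β m * γ m) * minorInv k q β γ (m + 1) := by
  rw [pivot, if_neg h0, if_neg hm.ne, minorRoot_of_lt hm, Cc_sub]
  linear_combination mul_minorInv (q := q) (β := β) (γ := γ) (show m + 1 ≤ k from hm)

lemma minorInv_mul_pivot_mul_minorInv (hk : β k * γ k = -1) {m : ℕ} (h0 : m ≠ 0) (hm : m ≤ k) :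
    Cc (β m * γ m) * (minorInv k q β γ m * pivot k q β γ m * minorInv k q β γ m) =
      minorInv k q β γ (m + 1) - minorInv k q β γ m := by
  rcases hm.eq_or_lt with rfl | hm
  · rw [minorInv_mul_pivot_self h0, minorInv_succ_self, hk, Cc, map_neg, map_one]
    ring
  · rw [minorInv_mul_pivot h0 hm]
    have h1 := mul_minorInv (q := q) (β := β) (γ := γ) hm.le
    have h2 := mul_minorInv (q := q) (β := β) (γ := γ) (show m + 1 ≤ k from hm)
    rw [minorRoot_of_lt hm, Cc_sub] at h1
    linear_combination minorInv k q β γ (m + 1) * h1 - minorInv k q β γ m * h2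

lemma minorInv_comm (m : ℕ) : minorInv k q β γ m = minorInv k q γ β m := by
  simp only [minorInv, minorRoot, mul_comm]

lemma upperEntry_self (i : ℕ) : upperEntry k q β γ i i = 1 := if_pos rfl

lemma upperEntry_of_lt {i j : ℕ} (h : i < j) :
    upperEntry k q β γ i j = Cc (β i * γ j) * minorInv k q β γ j := by
  rw [upperEntry, if_neg h.ne, if_pos h]

lemma upperEntry_of_gt {i j : ℕ} (h : j < i) : upperEntry k q β γ i j = 0 := by
  rw [upperEntry, if_neg h.ne', if_neg h.not_gt]

lemma sum_upperEntry (hβγ : β k * γ k = -1) {i j s : ℕ} (hs : s = max i j) (hsk : s ≤ k) :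
    ∑ m ∈ Finset.range (k + 1),
        upperEntry k q β γ i m * pivot k q β γ m * upperEntry k q γ β j m =
      upperEntry k q β γ i s * pivot k q β γ s * upperEntry k q γ β j s -
        Cc (β i * γ j) * minorInv k q β γ (s + 1) := by
  rw [Finset.range_eq_Ico, ← Finset.sum_Ico_consecutive _ (Nat.zero_le s) (by omega : s ≤ k + 1),
    Finset.sum_eq_sum_Ico_succ_bot (by omega : s < k + 1)]
  have hlow : ∑ m ∈ Finset.Ico 0 s,
      upperEntry k q β γ i m * pivot k q β γ m * upperEntry k q γ β j m = 0 := by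
    refine Finset.sum_eq_zero fun m hm => ?_
    have hms : m < s := (Finset.mem_Ico.1 hm).2
    rcases lt_max_iff.1 (hs ▸ hms) with h | h <;> simp [upperEntry_of_gt h]
  have htail : ∑ m ∈ Finset.Ico (s + 1) (k + 1),
      upperEntry k q β γ i m * pivot k q β γ m * upperEntry k q γ β j m =
        Cc (β i * γ j) * (minorInv k q β γ (k + 1) - minorInv k q β γ (s + 1)) := by
    rw [← Finset.sum_Ico_sub _ (by omega : s + 1 ≤ k + 1), Finset.mul_sum]
    refine Finset.sum_congr rfl fun m hm => ?_
    rw [Finset.mem_Ico] at hm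
    have hm' := minorInv_mul_pivot_mul_minorInv (q := q) hβγ (show m ≠ 0 by omega)
      (show m ≤ k by omega)
    rw [upperEntry_of_lt (by omega), upperEntry_of_lt (by omega), minorInv_comm (β := γ), ← hm']
    simp only [Cc_mul]
    ring
  rw [hlow, htail, minorInv_succ_self]
  ring

lemma upperFactor_mul_mul (hk : k ≠ 0) (h0 : β 0 * γ 0 = 1) (hβγ : β k * γ k = -1) :
    upperFactor k q β γ * Matrix.diagonal (fun i : Fin (k + 1) => pivot k q β γ i) *
      (upperFactor k q γ β)ᵀ = borderedMatrix k q β γ := by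
  ext1 i j
  have hi : (i : ℕ) ≤ k := by omega
  have hj : (j : ℕ) ≤ k := by omega
  rw [mul_apply]
  simp only [mul_diagonal, transpose_apply, upperFactor]
  rw [← Finset.sum_range fun m =>
      upperEntry k q β γ i m * pivot k q β γ m * upperEntry k q γ β j m,
    sum_upperEntry hβγ rfl (max_le hi hj)]
  simp only [borderedMatrix, Fin.ext_iff]
  obtain ⟨i, hi'⟩ := i
  obtain ⟨j, hj'⟩ := j
  simp only at hi hj ⊢
  rcases lt_trichotomy i j with h | rfl | h
  · rw [max_eq_right h.le, upperEntry_self, upperEntry_of_lt h, mul_one, mul_assoc,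
      if_neg (by omega)]
    rcases hj.eq_or_lt with rfl | hj
    · rw [minorInv_mul_pivot_self hk, minorInv_succ_self, if_pos (by omega)]
      ring
    · rw [minorInv_mul_pivot (by omega) hj, if_neg (by omega), if_neg (by omega), sub_self]
  · rw [max_self, upperEntry_self, upperEntry_self, one_mul, mul_one]
    rcases hi.eq_or_lt with rfl | hi
    · rw [minorInv_succ_self, if_pos ⟨rfl, rfl⟩, pivot, if_neg hk, if_pos rfl, mul_zero, sub_zero]
    · rw [if_neg (by omega), if_neg (by omega)]
      by_cases hi0 : i = 0
      · subst hi0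
        rw [h0, pivot, if_pos rfl, if_neg (by simp), Cc, map_one]
        ring
      · rw [pivot_of_lt hi0 hi, if_pos ⟨rfl, hi0⟩]
        ring
  · rw [max_eq_left h.le, upperEntry_self, upperEntry_of_lt h, one_mul, if_neg (by omega),
      minorInv_comm (β := γ), mul_comm (γ j)]
    rcases hi.eq_or_lt with rfl | hi
    · rw [minorInv_succ_self, if_pos (by omega)]
      linear_combination Cc (β i * γ j) * minorInv_mul_pivot_self (q := q) (β := β) (γ := γ) hk
    · rw [if_neg (by omega), if_neg (by omega)]
      linear_combination Cc (β i * γ j) *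
        minorInv_mul_pivot (q := q) (β := β) (γ := γ) (show i ≠ 0 by omega) hi

lemma memN1_upperFactor : MemN1 (upperFactor k q β γ) := by
  refine ⟨⟨fun i => upperEntry_self _, fun i j h => upperEntry_of_gt h⟩, fun i j h => ?_⟩
  rw [upperFactor]
  rcases lt_or_gt_of_ne h with h | h
  · rw [upperEntry_of_lt h]
    exact memO1_Cc_mul _ (memO1_minorInv _)
  · rw [upperEntry_of_gt h]
    exact memO1_zero

/-- The exponent of the leading power of `t` in the pivot at `m`. -/
def pivotExp (k m : ℕ) : ℤ := if m = 0 then -1 else if m = k then 1 else 0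

lemma memO1_pivot_mul_zpow_sub_one (hk : k ≠ 0) {m : ℕ} (hm : m ≤ k) :
    memO1 (pivot k q β γ m * tK ^ (-pivotExp k m) - 1) := by
  rcases eq_or_ne m 0 with rfl | h0
  · have h1 := mul_minorInv (q := q) (β := β) (γ := γ) (Nat.one_le_iff_ne_zero.2 hk)
    have h2 : pivot k q β γ 0 * tK ^ (-pivotExp k 0) - 1 =
        Cc (minorRoot k q β γ 1) * minorInv k q β γ 1 := by
      simp only [pivot, pivotExp, if_true, neg_neg, zpow_one]
      linear_combination h1
    rw [h2]
    exact memO1_Cc_mul _ (memO1_minorInv _)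
  · rcases hm.eq_or_lt with rfl | hm
    · have h2 : pivot m q β γ m * tK ^ (-pivotExp m m) - 1 = Cc (-q) * (tK - Cc 0)⁻¹ := by
        simp only [pivot, pivotExp, if_true, if_neg h0, _root_.zpow_neg_one, Cc, map_neg, map_zero,
          sub_zero]
        linear_combination mul_inv_cancel₀ tK_ne_zero
      rw [h2]
      exact memO1_Cc_mul _ (memO1_inv _)
    · rw [pivot_of_lt h0 hm, pivotExp, if_neg h0, if_neg hm.ne, neg_zero, zpow_zero, mul_one,
        add_sub_cancel_left]
      exact memO1_Cc_mul _ (memO1_minorInv _)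

lemma isGauss_borderedMatrix (hk : k ≠ 0) (h0 : β 0 * γ 0 = 1) (hβγ : β k * γ k = -1) :
    IsGauss (fun i : Fin (k + 1) => pivotExp k i) (borderedMatrix k q β γ) (upperFactor k q β γ)
      (Matrix.diagonal fun i : Fin (k + 1) => pivot k q β γ i * tK ^ (-pivotExp k i))
      (upperFactor k q γ β)ᵀ := by
  refine ⟨memN1_upperFactor, ⟨fun i j h => diagonal_apply_ne _ h, fun i => ?_⟩,
    memN1neg_iff_transpose.2 memN1_upperFactor, ?_⟩
  · rw [diagonal_apply_eq]
    exact memO1_pivot_mul_zpow_sub_one hk (by omega)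
  · rw [← upperFactor_mul_mul hk h0 hβγ, tPow, Matrix.mul_assoc (upperFactor k q β γ) _
      (Matrix.diagonal _), diagonal_mul_diagonal]
    congr 3
    funext i
    rw [mul_assoc, ← zpow_add₀ tK_ne_zero, neg_add_cancel, zpow_zero, mul_one]

lemma coeff_upperEntry_one {i j : ℕ} (hij : i < j) (hj : j ≤ k) :
    (upperEntry k q β γ i j).coeff 1 = β i * γ j := by
  rw [upperEntry_of_lt hij, coeff_Cc_mul, minorInv, if_pos hj, coeff_inv_one, mul_one]

lemma coeff_upperEntry_two {i : ℕ} (hi : i < k) :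
    (upperEntry k q β γ i k).coeff 2 = β i * γ k * q := by
  rw [upperEntry_of_lt hi, coeff_Cc_mul, minorInv, if_pos le_rfl, coeff_inv_two, minorRoot_self]

lemma ymat_eq_borderedMatrix (hk : k ≠ 0) (p e : ℂ) (b g : Fin (k - 1) → ℂ) :
    ymat k p e b g = borderedMatrix k (p + ∑ l, b l * g l) (bordered k e b (-1))
      (bordered k e⁻¹ g 1) := by
  ext1 i j
  simp only [ymat, borderedMatrix, Fin.ext_iff]
  have hi : (i : ℕ) ≤ k := by omega
  have hj : (j : ℕ) ≤ k := by omega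
  by_cases hik : (i : ℕ) = k
  · simp only [hik, hk, dif_neg, dif_pos, not_false_eq_true, true_and, true_or, if_true,
      bordered_self hk]
    split_ifs with h1 h2 h3
    · omega
    · simp [h1, bordered_zero]
    · rfl
    · rw [bordered_of_lt h1 (by omega), neg_one_mul]
  · by_cases hjk : (j : ℕ) = k
    · simp only [hik, hjk, dif_neg, dif_pos, not_false_eq_true, false_and, or_true, if_true,
        if_false, bordered_self hk, mul_one]
      split_ifs with h1 h2
      · simp [h1, bordered_zero]
      · omega
      · rw [bordered_of_lt h1 (by omega)]
    · simp only [hik, hjk, dif_neg, not_false_eq_true, false_and, or_false, if_false]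
      split_ifs <;> first | rfl | omega

end Factorization

lemma IsGauss.blockEmbed {n r k : ℕ} (hn : r - 1 + k < n) {ν : Fin n → ℤ}
    (hν : ∀ i ∉ Set.range (blockIdx hn), ν i = 0) {y u h l : Matrix (Fin (k + 1)) (Fin (k + 1)) K}
    (H : IsGauss (fun i => ν (blockIdx hn i)) y u h l) :
    IsGauss ν (blockEmbed n r k y) (blockEmbed n r k u) (blockEmbed n r k h)
      (blockEmbed n r k l) := by
  obtain ⟨hu, hh, hl, rfl⟩ := H
  refine ⟨hu.blockEmbed hn, hh.blockEmbed hn, hl.blockEmbed hn, ?_⟩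
  have : tPow ν = _root_.blockEmbed n r k (tPow fun i => ν (blockIdx hn i)) :=
    blockEmbed_diagonal hn _ fun i hi => by rw [hν i hi, zpow_zero]
  rw [this, blockEmbed_mul hn, blockEmbed_mul hn, blockEmbed_mul hn]

lemma neg_alphaCo_blockIdx {n r₁ r₂ k : ℕ} (hr1 : 1 ≤ r₁) (hrr : r₁ ≤ r₂)
    (hk : k = r₂ - r₁ + 1) (hn : r₁ - 1 + k < n) (i : Fin (k + 1)) :
    -alphaCo n r₁ r₂ (blockIdx hn i) = pivotExp k i := by
  simp only [alphaCo, blockIdx, pivotExp]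
  split_ifs <;> omega

lemma alphaCo_of_notMem {n r₁ r₂ k : ℕ} (hr1 : 1 ≤ r₁) (hrr : r₁ ≤ r₂)
    (hk : k = r₂ - r₁ + 1) (hn : r₁ - 1 + k < n) {i : Fin n} (hi : i ∉ Set.range (blockIdx hn)) :
    alphaCo n r₁ r₂ i = 0 := by
  have : ¬ (r₁ - 1 ≤ (i : ℕ) ∧ (i : ℕ) ≤ r₁ - 1 + k) := fun h =>
    hi ((exists_blockIdx hn h).imp fun _ => Eq.symm)
  rw [alphaCo, if_neg (by omega), if_neg (by omega)]

lemma blockEmbed_upperFactor_apply {n r k : ℕ} {q : ℂ} {β γ : ℕ → ℂ} (hn : r - 1 + k < n)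
    {i j : Fin n} {x y : ℕ} (hi : (i : ℕ) = x + (r - 1)) (hj : (j : ℕ) = y + (r - 1))
    (hx : x ≤ k) (hy : y ≤ k) :
    blockEmbed n r k (upperFactor k q β γ) i j = upperEntry k q β γ x y := by
  have hi' : i = blockIdx hn ⟨x, by omega⟩ := Fin.ext hi
  have hj' : j = blockIdx hn ⟨y, by omega⟩ := Fin.ext hj
  rw [hi', hj', blockEmbed_blockIdx, upperFactor]

/-- Every `y = τ_α(y(p,e,b,g)) ∈ Gr⁰_{−α}` lies in `Gr_{−α}`, has
`Φ_{α,k}(y) = e ≠ 0` (so `ξ_α(y)` is defined), and `ξ_α(y) = y`; i.e. `ξ_α` restricted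
to `Gr⁰_{−α}` is the identity. -/
theorem statement12 (n r₁ r₂ k : ℕ) (hn : 2 ≤ n) (hr1 : 1 ≤ r₁) (hrr : r₁ ≤ r₂)
    (hrn : r₂ < n) (hk : k = r₂ - r₁ + 1)
    (p e : ℂ) (he : e ≠ 0) (b g : Fin (k-1) → ℂ) :
    blockEmbed n r₁ k (ymat k p e b g) ∈ GrSlice (fun i => -alphaCo n r₁ r₂ i) ∧
    (∀ U h L : Matrix (Fin n) (Fin n) K,
      IsGauss (fun i => -alphaCo n r₁ r₂ i) (blockEmbed n r₁ k (ymat k p e b g)) U h L →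
        PhiOf n r₂ k hrn U ⟨k - 1, by omega⟩ = e ∧
        xiOf n r₁ r₂ k hr1 hrr hrn hk U = blockEmbed n r₁ k (ymat k p e b g)) := by
  have hn' : r₁ - 1 + k < n := by omega
  have hk0 : k ≠ 0 := by omega
  set q : ℂ := p + ∑ l, b l * g l with hq
  set β := bordered k e b (-1) with hβ
  set γ := bordered k e⁻¹ g 1 with hγ
  have hβ0 : β 0 = e := bordered_zero
  have hγk : γ k = 1 := bordered_self hk0
  have hG : IsGauss (fun i => -alphaCo n r₁ r₂ i) (blockEmbed n r₁ k (ymat k p e b g))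
      (blockEmbed n r₁ k (upperFactor k q β γ))
      (blockEmbed n r₁ k (Matrix.diagonal fun i => pivot k q β γ i * tK ^ (-pivotExp k i)))
      (blockEmbed n r₁ k (upperFactor k q γ β)ᵀ) := by
    refine IsGauss.blockEmbed hn' (fun i hi => ?_) ?_
    · rw [alphaCo_of_notMem hr1 hrr hk hn' hi, neg_zero]
    · simp only [neg_alphaCo_blockIdx hr1 hrr hk hn']
      rw [ymat_eq_borderedMatrix hk0]
      exact isGauss_borderedMatrix hk0 (by rw [bordered_zero, bordered_zero, mul_inv_cancel₀ he])
        (by rw [bordered_self hk0, bordered_self hk0, mul_one])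
  refine ⟨⟨_, _, _, hG⟩, fun U h L H => ?_⟩
  obtain rfl := H.upper_unique hG
  have hPhi : ∀ a : Fin k, PhiOf n r₂ k hrn (blockEmbed n r₁ k (upperFactor k q β γ)) a =
      β (k - 1 - a) := fun a => by
    rw [PhiOf, blockEmbed_upperFactor_apply hn' (x := k - 1 - a) (y := k)
      (by simp only; omega) (by simp only; omega) (by omega) le_rfl,
      coeff_upperEntry_one (by omega) le_rfl, hγk, mul_one]
  have hPhi_last : PhiOf n r₂ k hrn (blockEmbed n r₁ k (upperFactor k q β γ))
      ⟨k - 1, by omega⟩ = e := by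
    rw [hPhi, Nat.sub_self, hβ0]
  have hPhi_init : ∀ i : Fin (k - 1),
      PhiOf n r₂ k hrn (blockEmbed n r₁ k (upperFactor k q β γ))
        ⟨(i : ℕ), by have := i.isLt; omega⟩ = b i := by
    intro i
    rw [hPhi, hβ, bordered_of_lt (by simp only; omega) (by simp only; omega)]
    congr 1
    ext
    simp only
    omega
  have hZeta_last : ZetaOf n r₁ r₂ k hr1 hrr hrn hk (blockEmbed n r₁ k (upperFactor k q β γ))
      ⟨k - 1, by omega⟩ = e * q := by
    rw [ZetaOf, dif_pos rfl, blockEmbed_upperFactor_apply hn' (x := 0) (y := k)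
      (by simp only; omega) (by simp only; omega) (by omega) le_rfl,
      coeff_upperEntry_two (by omega), hβ0, hγk, mul_one]
  have hZeta_init : ∀ i : Fin (k - 1),
      ZetaOf n r₁ r₂ k hr1 hrr hrn hk (blockEmbed n r₁ k (upperFactor k q β γ))
        ⟨k - (i : ℕ) - 2, by omega⟩ / e = g i := by
    intro i
    rw [ZetaOf, dif_neg (by simp only; omega), blockEmbed_upperFactor_apply hn' (x := 0)
      (y := k - i - 1) (by simp only; omega) (by simp only; omega) (by omega) (by omega),
      coeff_upperEntry_one (by omega) (by omega), hβ0, mul_div_cancel_left₀ _ he, hγ,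
      bordered_of_lt (by omega) (by omega)]
    congr 1
    ext
    simp only
    omega
  refine ⟨hPhi_last, ?_⟩
  simp only [xiOf, hPhi_last, hPhi_init, hZeta_init, hZeta_last, mul_div_cancel_left₀ _ he]
  rw [hq, add_sub_cancel_right]
end
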